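/- Every orthohedral set S ⊆ ℤ^N is pei-isomorphic to a stack of orthants; consequently, two orthohedral sets are pei-isomorphic if and only if they have the same rank and the same height. -/

import Mathlib

open Pointwise

namespace PeiPaper

/-- Points of the face of the standard orthant spanned by the canonical basis vectors in `Y`. -/
def stdFace (N : ℕ) (Y : Finset (Fin N)) : Set (Fin N → ℤ) :=
  {v | (∀ i, 0 ≤ v i) ∧ ∀ i, i ∉ Y → v i = 0}

/-- Integral orthogonal matrix. -/
def IsOrthMat {N : ℕ} (A : Matrix (Fin N) (Fin N) ℤ) : Prop :=
  A * A.transpose = 1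

/-- `L` is an integral orthant of rank `k` in `ℤ^N`: an affine-orthogonal image of a
rank-`k` face of the standard orthant. -/
def IsOrthantOfRank {N : ℕ} (L : Set (Fin N → ℤ)) (k : ℕ) : Prop :=
  ∃ (a : Fin N → ℤ) (A : Matrix (Fin N) (Fin N) ℤ) (Y : Finset (Fin N)),
    IsOrthMat A ∧ Y.card = k ∧ L = (fun v => a + A.mulVec v) '' stdFace N Y

def IsOrthant {N : ℕ} (L : Set (Fin N → ℤ)) : Prop := ∃ k, IsOrthantOfRank L k

/-- `S` is orthohedral: a finite union of integral orthants. -/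
def IsOrthohedral {N : ℕ} (S : Set (Fin N → ℤ)) : Prop :=
  ∃ 𝓛 : Set (Set (Fin N → ℤ)), 𝓛.Finite ∧ (∀ L ∈ 𝓛, IsOrthant L) ∧ S = ⋃₀ 𝓛

/-- The rank of a set: the maximal rank of an orthant contained in it. -/
noncomputable def orthRank {N : ℕ} (S : Set (Fin N → ℤ)) : ℕ :=
  sSup {k | ∃ L, IsOrthantOfRank L k ∧ L ⊆ S}

/-- Commensurability: the intersection is nonempty and has the same rank as both sets. -/
def Commensurable {N : ℕ} (L L' : Set (Fin N → ℤ)) : Prop :=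
  (L ∩ L').Nonempty ∧ orthRank L = orthRank (L ∩ L') ∧ orthRank L' = orthRank (L ∩ L')

/-- The rank-`k` orthants contained in `S`. -/
def germSet {N : ℕ} (S : Set (Fin N → ℤ)) (k : ℕ) : Set (Set (Fin N → ℤ)) :=
  {L | IsOrthantOfRank L k ∧ L ⊆ S}

/-- The rank-`k` germs of `S`: commensurability classes of rank-`k` orthants of `S`. -/
def Germ {N : ℕ} (S : Set (Fin N → ℤ)) (k : ℕ) : Type _ :=
  Quot (fun L L' : germSet S k => Commensurable L.1 L'.1)

def germOf {N : ℕ} (S : Set (Fin N → ℤ)) (k : ℕ) (L : germSet S k) : Germ S k :=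
  Quot.mk _ L

/-- The number of rank-`k` germs of `S` (as a natural number; `0` if infinite). -/
noncomputable def heightAt {N : ℕ} (S : Set (Fin N → ℤ)) (k : ℕ) : ℕ :=
  Nat.card (Germ S k)

/-- The height of an orthohedral set: the number of germs of maximal rank. -/
noncomputable def height {N : ℕ} (S : Set (Fin N → ℤ)) : ℕ :=
  heightAt S (orthRank S)

/-- `f` is (the restriction of) an isometry of `ℤ^N` on `L`. -/
def IsometricOn {N : ℕ} (f : (Fin N → ℤ) → (Fin N → ℤ)) (L : Set (Fin N → ℤ)) : Prop :=
  ∃ (a : Fin N → ℤ) (A : Matrix (Fin N) (Fin N) ℤ),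
    IsOrthMat A ∧ ∀ x ∈ L, f x = a + A.mulVec x

/-- `f` is (the restriction of) a translation on `L`. -/
def TranslationOn {N : ℕ} (f : (Fin N → ℤ) → (Fin N → ℤ)) (L : Set (Fin N → ℤ)) : Prop :=
  ∃ a : Fin N → ℤ, ∀ x ∈ L, f x = a + x

/-- `f` is a piecewise-Euclidean-isometric map on `S`. -/
def IsPeiMapOn {N : ℕ} (S : Set (Fin N → ℤ)) (f : (Fin N → ℤ) → (Fin N → ℤ)) : Prop :=
  ∃ 𝓛 : Set (Set (Fin N → ℤ)), 𝓛.Finite ∧ (∀ L ∈ 𝓛, IsOrthant L) ∧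
    S = ⋃₀ 𝓛 ∧ 𝓛.PairwiseDisjoint id ∧ ∀ L ∈ 𝓛, IsometricOn f L

/-- `f` is a piecewise-Euclidean-translation map on `S`. -/
def IsPetMapOn {N : ℕ} (S : Set (Fin N → ℤ)) (f : (Fin N → ℤ) → (Fin N → ℤ)) : Prop :=
  ∃ 𝓛 : Set (Set (Fin N → ℤ)), 𝓛.Finite ∧ (∀ L ∈ 𝓛, IsOrthant L) ∧
    S = ⋃₀ 𝓛 ∧ 𝓛.PairwiseDisjoint id ∧ ∀ L ∈ 𝓛, TranslationOn f L

def IsPeiIso {N : ℕ} (S S' : Set (Fin N → ℤ)) (f : (Fin N → ℤ) → (Fin N → ℤ)) : Prop :=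
  IsPeiMapOn S f ∧ Set.InjOn f S ∧ f '' S = S'

def PeiIsomorphic {N : ℕ} (S S' : Set (Fin N → ℤ)) : Prop := ∃ f, IsPeiIso S S' f

def IsPetIso {N : ℕ} (S S' : Set (Fin N → ℤ)) (f : (Fin N → ℤ) → (Fin N → ℤ)) : Prop :=
  IsPetMapOn S f ∧ Set.InjOn f S ∧ f '' S = S'

def PetIsomorphic {N : ℕ} (S S' : Set (Fin N → ℤ)) : Prop := ∃ f, IsPetIso S S' f

/-- A pei-permutation of `S`: a permutation of `ℤ^N` supported on `S` which is pei on `S`. -/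
def IsPeiPerm {N : ℕ} (S : Set (Fin N → ℤ)) (g : Equiv.Perm (Fin N → ℤ)) : Prop :=
  IsPeiMapOn S ⇑g ∧ ∀ x ∉ S, g x = x

/-- The element `g` has rank at most `k`: it is supported on an orthohedral set of rank `≤ k`. -/
def rankLE {N : ℕ} (g : Equiv.Perm (Fin N → ℤ)) (k : ℕ) : Prop :=
  ∃ T : Set (Fin N → ℤ), IsOrthohedral T ∧ orthRank T ≤ k ∧ ∀ x ∉ T, g x = x

/-- `g` fixes every rank-`k` germ of `S`. -/
def FixesGerm {N : ℕ} (S : Set (Fin N → ℤ)) (k : ℕ) (g : Equiv.Perm (Fin N → ℤ)) : Prop :=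
  ∀ L, IsOrthantOfRank L k → L ⊆ S →
    ∃ L', IsOrthantOfRank L' k ∧ L' ⊆ L ∧ Commensurable L L' ∧
      IsometricOn (⇑g) L' ∧ Commensurable (⇑g '' L') L

/-- `g` fixes every rank-`k` germ of `S` and acts on its tangent coset by a translation. -/
def TranslatesGerm {N : ℕ} (S : Set (Fin N → ℤ)) (k : ℕ) (g : Equiv.Perm (Fin N → ℤ)) : Prop :=
  ∀ L, IsOrthantOfRank L k → L ⊆ S →
    ∃ L' a, IsOrthantOfRank L' k ∧ L' ⊆ L ∧ Commensurable L L' ∧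
      (∀ x ∈ L', g x = a + x) ∧ Commensurable (⇑g '' L') L

/-- `σ` is the map induced by `g` on the rank-`k` germs of `S`. -/
def InducesGermMap {N : ℕ} (S : Set (Fin N → ℤ)) (k : ℕ) (g : Equiv.Perm (Fin N → ℤ))
    (σ : Germ S k → Germ S k) : Prop :=
  ∀ L : germSet S k, ∃ (L'' : Set (Fin N → ℤ)) (M : germSet S k),
    IsOrthantOfRank L'' k ∧ L'' ⊆ L.1 ∧ Commensurable L.1 L'' ∧
    M.1 = ⇑g '' L'' ∧ σ (germOf S k L) = germOf S k M

/-- A finitary permutation which is even (has sign `1` on a finite invariant subset). -/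
def IsEvenFinitary {α : Type*} (σ : Equiv.Perm α) : Prop :=
  ∃ (F : Finset α) (σF : Equiv.Perm F),
    (∀ a ∉ F, σ a = a) ∧ (∀ a : F, σ (a : α) = (σF a : α)) ∧
    @Equiv.Perm.sign F (Classical.decEq _) inferInstance σF = 1

/-- `g` induces an even finitary permutation on the rank-`k` germs of `S`. -/
def IsEvenOnGerms {N : ℕ} (S : Set (Fin N → ℤ)) (k : ℕ) (g : Equiv.Perm (Fin N → ℤ)) : Prop :=
  ∃ σ : Equiv.Perm (Germ S k), InducesGermMap S k g ⇑σ ∧ IsEvenFinitary σ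

/-- Ordering of germs (of arbitrary ranks): `p ≤ q` if they have representatives `L ⊆ L'`. -/
def germLE {N : ℕ} (S : Set (Fin N → ℤ)) (p q : Σ k, Germ S k) : Prop :=
  ∃ (L : germSet S p.1) (L' : germSet S q.1),
    germOf S p.1 L = p.2 ∧ germOf S q.1 L' = q.2 ∧ L.1 ⊆ L'.1

/-- A maximal germ of `S`. -/
def IsMaxGerm {N : ℕ} (S : Set (Fin N → ℤ)) (p : Σ k, Germ S k) : Prop :=
  ∀ q, germLE S p q → germLE S q p

/-- A `0`-based orthant. -/
def IsBasedOrthant {N : ℕ} (L0 : Set (Fin N → ℤ)) : Prop :=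
  ∃ (A : Matrix (Fin N) (Fin N) ℤ) (Y : Finset (Fin N)),
    IsOrthMat A ∧ L0 = (fun v => A.mulVec v) '' stdFace N Y

/-- Two (oriented) parallel orthants. -/
def ParallelOrthants {N : ℕ} (L L' : Set (Fin N → ℤ)) : Prop :=
  ∃ a : Fin N → ℤ, L' = a +ᵥ L

/-- The indicator image `S_τ` of `S`: the union of the `0`-based parallel translates of
the orthants contained in `S`. -/
def indicatorImage {N : ℕ} (S : Set (Fin N → ℤ)) : Set (Fin N → ℤ) :=
  ⋃₀ {L0 | IsBasedOrthant L0 ∧ ∃ a : Fin N → ℤ, (a +ᵥ L0) ⊆ S}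

/-- The height function `h_S`: the number of maximal germs of `S` whose indicator is `L0`. -/
noncomputable def hFun {N : ℕ} (S : Set (Fin N → ℤ)) (L0 : Set (Fin N → ℤ)) : ℕ :=
  Nat.card {p : Σ k, Germ S k //
    IsMaxGerm S p ∧ ∃ L : germSet S p.1, germOf S p.1 L = p.2 ∧ ∃ a : Fin N → ℤ, L.1 = a +ᵥ L0}

/-- `S` is quasi-normal: the maximal based orthants of `S_τ` are exactly the support of `h_S`. -/
def QuasiNormal {N : ℕ} (S : Set (Fin N → ℤ)) : Prop :=
  ∀ L0 : Set (Fin N → ℤ),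
    (IsBasedOrthant L0 ∧ L0 ⊆ indicatorImage S ∧
      ∀ L1, IsBasedOrthant L1 → L1 ⊆ indicatorImage S → L0 ⊆ L1 → L1 ⊆ L0)
    ↔ (IsBasedOrthant L0 ∧ 0 < hFun S L0)

/-- The germ `q` of `S'` is the image of the germ `p` of `S` under the injective pei-map `f`. -/
def GermMapsTo {N : ℕ} (f : (Fin N → ℤ) → (Fin N → ℤ)) (S S' : Set (Fin N → ℤ))
    (p : Σ k, Germ S k) (q : Σ k, Germ S' k) : Prop :=
  p.1 = q.1 ∧ ∃ (L : germSet S p.1) (L'' : Set (Fin N → ℤ)) (M : germSet S' q.1),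
    germOf S p.1 L = p.2 ∧ IsOrthantOfRank L'' p.1 ∧ L'' ⊆ L.1 ∧ Commensurable L.1 L'' ∧
    M.1 = f '' L'' ∧ germOf S' q.1 M = q.2

/-- A stack of `h` parallel rank-`n` orthants. -/
def IsStack {N : ℕ} (S : Set (Fin N → ℤ)) (n h : ℕ) : Prop :=
  ∃ (L0 : Set (Fin N → ℤ)) (a : Fin h → (Fin N → ℤ)),
    IsOrthantOfRank L0 n ∧
    (Pairwise fun i j => Disjoint (a i +ᵥ L0) (a j +ᵥ L0)) ∧
    S = ⋃ i, a i +ᵥ L0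

/-- A coordinate half-space of `ℤ^N`. -/
def IsHalfSpace {N : ℕ} (H : Set (Fin N → ℤ)) : Prop :=
  ∃ (i : Fin N) (c : ℤ), H = {x | x i ≤ c} ∨ H = {x | c ≤ x i}

/-- The canonical embedding `ℤ^N → ℤ^{N+1}`. -/
def emb (N : ℕ) (x : Fin N → ℤ) : Fin (N + 1) → ℤ :=
  fun i => if h : (i : ℕ) < N then x ⟨i, h⟩ else 0

/-- The sum of all matrix entries of a finitely supported family of vectors. -/
noncomputable def totalSum (k : ℕ) (Γ : Type*) : (Γ →₀ (Fin k → ℤ)) →+ ℤ :=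
  Finsupp.liftAddHom (fun _ => ∑ i : Fin k, Pi.evalAddMonoidHom (fun _ => ℤ) i)

/-- The clique (flag) complex of a graph. -/
def cliqueComplex {V : Type*} (G : SimpleGraph V) : Set (Finset V) :=
  {s | s.Nonempty ∧ G.IsClique (s : Set V)}

/-- The geometric realization of a simplicial complex on vertex set `V`. -/
def realization {V : Type*} (K : Set (Finset V)) : Set (V → ℝ) :=
  {f | (∀ v, 0 ≤ f v) ∧ ∃ s ∈ K, Function.support f ⊆ ↑s ∧ ∑ v ∈ s, f v = 1}

/-- A wedge (bouquet) of `n`-spheres indexed by `ι`, with basepoint `b`. -/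
noncomputable def wedgeSpheres (ι : Type) (n : ℕ)
    (b : Metric.sphere (0 : EuclideanSpace ℝ (Fin (n + 1))) 1) : Type :=
  Quot (fun p q : Unit ⊕ (ι × Metric.sphere (0 : EuclideanSpace ℝ (Fin (n + 1))) 1) =>
    (Sum.elim (fun _ => True) (fun pr => pr.2 = b) p) ∧
    (Sum.elim (fun _ => True) (fun qr => qr.2 = b) q))

noncomputable instance (ι : Type) (n : ℕ) (b : Metric.sphere (0 : EuclideanSpace ℝ (Fin (n + 1))) 1) :
    TopologicalSpace (wedgeSpheres ι n b) :=
  letI : TopologicalSpace ι := ⊥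
  instTopologicalSpaceQuot


/-- The axis-parallel orthant with apex `a` and direction vector `ε`. -/
def box {N : ℕ} (a : Fin N → ℤ) (ε : Fin N → SignType) : Set (Fin N → ℤ) :=
  {x | ∀ j, ∃ t : ℕ, x j = a j + (ε j : ℤ) * t}

/-- The coordinate directions in which the orthant `box a ε` is unbounded. -/
def directions {N : ℕ} (ε : Fin N → SignType) : Finset (Fin N) :=
  Finset.univ.filter fun j => ε j ≠ 0

lemma mem_directions {N : ℕ} {ε : Fin N → SignType} {j : Fin N} :
    j ∈ directions ε ↔ ε j ≠ 0 := by
  simp [directions]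

lemma IsOrthMat.mul {N : ℕ} {A B : Matrix (Fin N) (Fin N) ℤ} (hA : IsOrthMat A)
    (hB : IsOrthMat B) : IsOrthMat (A * B) := by
  unfold IsOrthMat at *
  rw [Matrix.transpose_mul, Matrix.mul_assoc, ← Matrix.mul_assoc B, hB, Matrix.one_mul, hA]

lemma IsOrthMat.transpose_mul_self {N : ℕ} {A : Matrix (Fin N) (Fin N) ℤ} (hA : IsOrthMat A) :
    A.transpose * A = 1 :=
  mul_eq_one_comm.mp hA

lemma IsOrthMat.transpose {N : ℕ} {A : Matrix (Fin N) (Fin N) ℤ} (hA : IsOrthMat A) :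
    IsOrthMat A.transpose := by
  simpa [IsOrthMat] using hA.transpose_mul_self

lemma isOrthMat_permMatrix {N : ℕ} (σ : Equiv.Perm (Fin N)) : IsOrthMat (σ.permMatrix ℤ) := by
  rw [IsOrthMat, Matrix.transpose_permMatrix, ← Matrix.permMatrix_mul]
  simp

lemma exists_unique_support_of_sum_sq_eq_one {ι : Type*} [Fintype ι] {v : ι → ℤ}
    (h : ∑ j, v j * v j = 1) :
    ∃ j, (v j = 1 ∨ v j = -1) ∧ ∀ i, i ≠ j → v i = 0 := by
  classical
  obtain ⟨j, hj⟩ : ∃ j, v j ≠ 0 := by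
    by_contra! h0
    simp [h0] at h
  rw [← Finset.add_sum_erase _ _ (Finset.mem_univ j)] at h
  have hpos : 1 ≤ v j * v j := Int.add_one_le_iff.mpr (mul_self_pos.mpr hj)
  have hnonneg : ∀ i ∈ Finset.univ.erase j, 0 ≤ v i * v i := fun i _ => mul_self_nonneg _
  have hsum := Finset.sum_nonneg hnonneg
  have hzero : ∑ i ∈ Finset.univ.erase j, v i * v i = 0 := by omega
  refine ⟨j, ?_, fun i hi => ?_⟩
  · rw [hzero, add_zero] at h
    exact mul_self_eq_one_iff.mp h
  · exact mul_self_eq_zero.mp ((Finset.sum_eq_zero_iff_of_nonneg hnonneg).mp hzero i (by simp [hi]))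

/-- An integral orthogonal matrix is a signed permutation matrix. -/
lemma IsOrthMat.exists_mulVec {N : ℕ} {A : Matrix (Fin N) (Fin N) ℤ} (hA : IsOrthMat A) :
    ∃ (σ : Equiv.Perm (Fin N)) (s : Fin N → SignType),
      (∀ i, s i ≠ 0) ∧ ∀ v i, A.mulVec v i = (s i : ℤ) * v (σ i) := by
  have hrow : ∀ i, ∃ j, (A i j = 1 ∨ A i j = -1) ∧ ∀ k, k ≠ j → A i k = 0 := fun i => by
    apply exists_unique_support_of_sum_sq_eq_one
    simpa [Matrix.mul_apply] using congrFun (congrFun hA i) i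
  choose τ hτ hτ0 using hrow
  have hinj : Function.Injective τ := by
    intro i i' h
    by_contra hne
    have h0 : ∑ j, A i j * A i' j = 0 := by
      simpa [Matrix.mul_apply, Matrix.one_apply, hne] using congrFun (congrFun hA i) i'
    rw [Finset.sum_eq_single (τ i) (fun j _ hj => by simp [hτ0 i j hj]) (by simp)] at h0
    have h1 := hτ i
    have h2 := hτ i'
    rw [← h] at h2
    rcases h1 with h1 | h1 <;> rcases h2 with h2 | h2 <;> simp [h1, h2] at h0
  refine ⟨Equiv.ofBijective τ (Finite.injective_iff_bijective.mp hinj),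
    fun i => if A i (τ i) = 1 then 1 else -1, fun i => ?_, fun v i => ?_⟩
  · dsimp only
    split_ifs <;> decide
  · rw [Matrix.mulVec, dotProduct,
      Finset.sum_eq_single (τ i) (fun j _ hj => by simp [hτ0 i j hj]) (by simp)]
    rcases hτ i with h | h <;> simp [h]

lemma IsOrthantOfRank.exists_box {N : ℕ} {L : Set (Fin N → ℤ)} {k : ℕ}
    (h : IsOrthantOfRank L k) : ∃ a ε, (directions ε).card = k ∧ L = box a ε := by
  obtain ⟨a, A, Y, hA, rfl, rfl⟩ := h
  obtain ⟨σ, s, hs, hv⟩ := hA.exists_mulVec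
  refine ⟨a, fun i => if σ i ∈ Y then s i else 0, ?_, ?_⟩
  · refine Finset.card_bij (fun i _ => σ i) (fun i hi => ?_) (fun i _ j _ h => σ.injective h)
      (fun j hj => ⟨σ.symm j, ?_, by simp⟩)
    · by_contra hY
      simp [mem_directions, hY] at hi
    · simp [mem_directions, hj, hs]
  · ext x
    constructor
    · rintro ⟨v, ⟨hv0, hvY⟩, rfl⟩ i
      refine ⟨(v (σ i)).toNat, ?_⟩
      simp only [Pi.add_apply, hv, Int.toNat_of_nonneg (hv0 _)]
      split_ifs with hi
      · rfl
      · simp [hvY _ hi]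
    · intro hx
      choose t ht using hx
      refine ⟨fun j => if j ∈ Y then (t (σ.symm j) : ℤ) else 0, ⟨fun j => ?_, fun j hj => ?_⟩, ?_⟩
      · dsimp only
        split_ifs <;> simp
      · simp [hj]
      · ext i
        simp only [Pi.add_apply, hv, ht, Equiv.symm_apply_apply]
        split_ifs <;> simp

lemma isOrthantOfRank_box {N : ℕ} (a : Fin N → ℤ) (ε : Fin N → SignType) :
    IsOrthantOfRank (box a ε) (directions ε).card := by
  set d : Fin N → ℤ := fun i => if ε i = 0 then 1 else (ε i : ℤ) with hd
  refine ⟨a, Matrix.diagonal d, directions ε, ?_, rfl, ?_⟩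
  · rw [IsOrthMat, Matrix.diagonal_transpose, Matrix.diagonal_mul_diagonal, ← Matrix.diagonal_one]
    congr 1
    ext i
    simp only [hd]
    generalize ε i = e
    revert e
    decide
  · ext x
    constructor
    · intro hx
      choose t ht using hx
      refine ⟨fun j => if ε j = 0 then 0 else (t j : ℤ), ⟨fun j => ?_, fun j hj => ?_⟩, ?_⟩
      · dsimp only
        split_ifs <;> simp
      · simpa [mem_directions] using fun h => absurd h (by simpa [mem_directions] using hj)
      · ext i
        simp only [Pi.add_apply, Matrix.mulVec_diagonal, ht, hd]
        split_ifs with h <;> simp [h]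
    · rintro ⟨v, ⟨hv0, hvY⟩, rfl⟩ i
      refine ⟨(v i).toNat, ?_⟩
      simp only [Pi.add_apply, Matrix.mulVec_diagonal, hd, Int.toNat_of_nonneg (hv0 _)]
      split_ifs with h
      · simp [h, hvY i (by simp [mem_directions, h])]
      · rfl

lemma IsOrthantOfRank.nonempty {N : ℕ} {L : Set (Fin N → ℤ)} {k : ℕ}
    (h : IsOrthantOfRank L k) : L.Nonempty := by
  obtain ⟨a, ε, -, rfl⟩ := h.exists_box
  exact ⟨a, fun j => ⟨0, by simp⟩⟩

lemma isOrthantOfRank_singleton {N : ℕ} (x : Fin N → ℤ) : IsOrthantOfRank {x} 0 := by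
  have h := isOrthantOfRank_box x 0
  have h0 : directions (0 : Fin N → SignType) = ∅ := by simp [directions]
  have hx : box x 0 = {x} := by
    ext y
    simp [box, funext_iff]
  rwa [h0, hx] at h


lemma direction_of_frequently_mem_ray {a b : ℤ} {ε δ : SignType} {u : ℕ}
    (hu : ∃ t : ℕ, a + (ε : ℤ) * u = b + (δ : ℤ) * t)
    (h : ∀ w : ℕ, ∃ v ≥ w, ∃ t : ℕ, a + (ε : ℤ) * v = b + (δ : ℤ) * t) :
    ε = 0 ∨ ε = δ := by
  obtain ⟨t, ht⟩ := hu
  obtain ⟨v, hv, t', ht'⟩ := h (u + a.natAbs + b.natAbs + 1)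
  cases ε <;> cases δ <;> simp at * <;> omega

lemma direction_eq_of_box_subset {N : ℕ} {a c : Fin N → ℤ} {ε γ : Fin N → SignType}
    (h : box c γ ⊆ box a ε) {j : Fin N} (hj : γ j ≠ 0) : γ j = ε j := by
  have hmem : ∀ v : ℕ, ∃ t : ℕ, c j + (γ j : ℤ) * v = a j + (ε j : ℤ) * t := fun v =>
    h (show (fun i => c i + (γ i : ℤ) * v) ∈ box c γ from fun _ => ⟨v, rfl⟩) j
  exact (direction_of_frequently_mem_ray (hmem 0) fun w => ⟨w, le_rfl, hmem w⟩).resolve_left hj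

lemma IsOrthantOfRank.le_of_subset {N : ℕ} {K L : Set (Fin N → ℤ)} {k l : ℕ}
    (hK : IsOrthantOfRank K k) (hL : IsOrthantOfRank L l) (h : K ⊆ L) : k ≤ l := by
  obtain ⟨c, γ, rfl, rfl⟩ := hK.exists_box
  obtain ⟨a, ε, rfl, rfl⟩ := hL.exists_box
  refine Finset.card_le_card fun j hj => ?_
  rw [mem_directions] at hj ⊢
  rwa [← direction_eq_of_box_subset h hj]

lemma IsOrthantOfRank.exists_box_of_subset_box {N : ℕ} {K : Set (Fin N → ℤ)} {a : Fin N → ℤ}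
    {ε : Fin N → SignType} (hK : IsOrthantOfRank K (directions ε).card) (h : K ⊆ box a ε) :
    ∃ c ∈ box a ε, K = box c ε := by
  obtain ⟨c, γ, hcard, rfl⟩ := hK.exists_box
  have hsub : directions γ ⊆ directions ε := fun j hj => by
    rw [mem_directions] at hj ⊢
    rwa [← direction_eq_of_box_subset h hj]
  have heq := Finset.eq_of_subset_of_card_le hsub hcard.ge
  have hγ : γ = ε := by
    ext1 j
    by_cases hj : γ j = 0
    · have : j ∉ directions ε := by simpa [← heq, mem_directions] using hj
      rw [mem_directions, not_not] at this
      rw [hj, this]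
    · exact direction_eq_of_box_subset h hj
  exact ⟨c, h fun j => ⟨0, by simp⟩, by rw [hγ]⟩

/-- Two full-rank suborthants of an orthant share a full-rank suborthant. -/
lemma IsOrthantOfRank.exists_subset_inter {N : ℕ} {K K' M : Set (Fin N → ℤ)} {n : ℕ}
    (hM : IsOrthantOfRank M n) (hK : IsOrthantOfRank K n) (hK' : IsOrthantOfRank K' n)
    (h : K ⊆ M) (h' : K' ⊆ M) : ∃ K'', IsOrthantOfRank K'' n ∧ K'' ⊆ K ∩ K' := by
  obtain ⟨a, ε, rfl, rfl⟩ := hM.exists_box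
  obtain ⟨c, hc, rfl⟩ := hK.exists_box_of_subset_box h
  obtain ⟨d, hd, rfl⟩ := hK'.exists_box_of_subset_box h'
  choose s hs using hc
  choose t ht using hd
  refine ⟨box (fun j => a j + (ε j : ℤ) * (s j + t j)) ε, isOrthantOfRank_box _ _,
    fun x hx => ⟨fun j => ?_, fun j => ?_⟩⟩ <;> obtain ⟨u, hu⟩ := hx j
  · exact ⟨t j + u, by rw [hu, hs]; push_cast; ring⟩
  · exact ⟨s j + u, by rw [hu, ht]; push_cast; ring⟩

/-- An orthant covered by finitely many orthants has a full-rank suborthant in one of them. -/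
lemma IsOrthantOfRank.exists_subset_inter_of_subset_sUnion {N : ℕ} {M : Set (Fin N → ℤ)} {k : ℕ}
    {𝓛 : Set (Set (Fin N → ℤ))} (hM : IsOrthantOfRank M k) (hfin : 𝓛.Finite)
    (h𝓛 : ∀ L ∈ 𝓛, IsOrthant L) (h : M ⊆ ⋃₀ 𝓛) :
    ∃ L ∈ 𝓛, ∃ K, IsOrthantOfRank K k ∧ K ⊆ M ∩ L := by
  obtain ⟨a, ε, rfl, rfl⟩ := hM.exists_box
  let p : ℕ → Fin N → ℤ := fun t j => a j + (ε j : ℤ) * t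
  have hp : ∀ t, p t ∈ box a ε := fun t j => ⟨t, rfl⟩
  obtain ⟨L, hL, hinf⟩ : ∃ L ∈ 𝓛, {t | p t ∈ L}.Infinite := by
    by_contra! hcon
    refine Set.infinite_univ (α := ℕ) ((hfin.biUnion hcon).subset fun t _ => ?_)
    obtain ⟨L, hL, ht⟩ := h (hp t)
    exact Set.mem_biUnion hL ht
  obtain ⟨l, hl⟩ := h𝓛 L hL
  obtain ⟨b, δ, -, rfl⟩ := hl.exists_box
  obtain ⟨u, hu⟩ := hinf.nonempty
  refine ⟨_, hL, box (p u) ε, isOrthantOfRank_box _ _, fun x hx => ⟨fun j => ?_, fun j => ?_⟩⟩ <;>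
    obtain ⟨s, hs⟩ := hx j
  · exact ⟨u + s, by simp only [hs, p]; push_cast; ring⟩
  · have hfreq : ∀ w : ℕ, ∃ v ≥ w, ∃ t : ℕ, a j + (ε j : ℤ) * v = b j + (δ j : ℤ) * t := fun w => by
      obtain ⟨v, hv, hw⟩ := hinf.exists_gt w
      exact ⟨v, hw.le, hv j⟩
    obtain ⟨t, ht⟩ := hu j
    rcases direction_of_frequently_mem_ray (hu j) hfreq with h0 | h0
    · exact ⟨t, by simpa [hs, h0] using ht⟩
    · exact ⟨t + s, by rw [hs, ht, h0]; push_cast; ring⟩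

lemma orthRank_eq {N : ℕ} {S K : Set (Fin N → ℤ)} {n : ℕ} (hK : IsOrthantOfRank K n)
    (h : K ⊆ S) (hS : ∀ L k, IsOrthantOfRank L k → L ⊆ S → k ≤ n) : orthRank S = n :=
  IsGreatest.csSup_eq ⟨⟨K, hK, h⟩, fun _ ⟨L, hL, hLS⟩ => hS L _ hL hLS⟩

lemma IsOrthantOfRank.orthRank_eq {N : ℕ} {L : Set (Fin N → ℤ)} {n : ℕ}
    (hL : IsOrthantOfRank L n) : orthRank L = n :=
  PeiPaper.orthRank_eq hL subset_rfl fun _ _ hK h => hK.le_of_subset hL h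

lemma commensurable_iff {N : ℕ} {L L' : Set (Fin N → ℤ)} {n : ℕ} (hL : IsOrthantOfRank L n)
    (hL' : IsOrthantOfRank L' n) :
    Commensurable L L' ↔ ∃ K, IsOrthantOfRank K n ∧ K ⊆ L ∩ L' := by
  have hbound : ∀ M k, IsOrthantOfRank M k → M ⊆ L ∩ L' → k ≤ n := fun M k hM h =>
    hM.le_of_subset hL (h.trans Set.inter_subset_left)
  constructor
  · rintro ⟨⟨x, hx⟩, h, -⟩
    have hmem := Nat.sSup_mem (s := {k | ∃ M, IsOrthantOfRank M k ∧ M ⊆ L ∩ L'})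
      ⟨0, {x}, isOrthantOfRank_singleton x, Set.singleton_subset_iff.mpr hx⟩
      ⟨n, fun k ⟨M, hM, h⟩ => hbound M k hM h⟩
    change ∃ M, IsOrthantOfRank M (orthRank (L ∩ L')) ∧ M ⊆ L ∩ L' at hmem
    rwa [← h, hL.orthRank_eq] at hmem
  · rintro ⟨K, hK, h⟩
    have hrank := orthRank_eq hK h hbound
    exact ⟨hK.nonempty.mono h, by rw [hrank, hL.orthRank_eq], by rw [hrank, hL'.orthRank_eq]⟩

/-- `S` is the disjoint union of a finite family of orthants with multiset of ranks `m`. -/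
def HasRanks {N : ℕ} (S : Set (Fin N → ℤ)) (m : Multiset ℕ) : Prop :=
  ∃ 𝓛 : Finset (Set (Fin N → ℤ)), (∀ L ∈ 𝓛, IsOrthant L) ∧
    (𝓛 : Set (Set (Fin N → ℤ))).PairwiseDisjoint id ∧ S = ⋃₀ 𝓛 ∧ 𝓛.val.map orthRank = m

lemma IsOrthant.isOrthantOfRank {N : ℕ} {L : Set (Fin N → ℤ)} (hL : IsOrthant L) :
    IsOrthantOfRank L (orthRank L) := by
  obtain ⟨k, hk⟩ := hL
  rwa [hk.orthRank_eq]

lemma HasRanks.empty {N : ℕ} : HasRanks (∅ : Set (Fin N → ℤ)) 0 :=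
  ⟨∅, by simp, by simp, by simp, rfl⟩

lemma HasRanks.union {N : ℕ} {S T : Set (Fin N → ℤ)} {m m' : Multiset ℕ} (hS : HasRanks S m)
    (hT : HasRanks T m') (h : Disjoint S T) : HasRanks (S ∪ T) (m + m') := by
  classical
  obtain ⟨𝓛, h𝓛, hd, rfl, rfl⟩ := hS
  obtain ⟨𝓜, h𝓜, hd', rfl, rfl⟩ := hT
  have hLM : ∀ L ∈ 𝓛, ∀ M ∈ 𝓜, Disjoint L M := fun L hL M hM =>
    h.mono (Set.subset_sUnion_of_mem hL) (Set.subset_sUnion_of_mem hM)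
  have hdisj : Disjoint 𝓛 𝓜 := Finset.disjoint_left.mpr fun L hL hM => by
    obtain ⟨k, hk⟩ := h𝓛 L hL
    exact hk.nonempty.ne_empty (disjoint_self.mp (hLM L hL L hM))
  refine ⟨𝓛.disjUnion 𝓜 hdisj, ?_, ?_, ?_, ?_⟩
  · intro L hL
    rcases Finset.mem_disjUnion.mp hL with hL | hL
    exacts [h𝓛 L hL, h𝓜 L hL]
  · rw [Finset.coe_disjUnion, Set.pairwiseDisjoint_union]
    exact ⟨hd, hd', fun L hL M hM _ => hLM L hL M hM⟩
  · rw [Finset.coe_disjUnion, Set.sUnion_union]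
  · simp [Finset.disjUnion]

lemma IsOrthantOfRank.hasRanks {N : ℕ} {L : Set (Fin N → ℤ)} {k : ℕ}
    (hL : IsOrthantOfRank L k) : HasRanks L {k} :=
  ⟨{L}, by simpa using ⟨k, hL⟩, by simp, by simp, by simp [hL.orthRank_eq]⟩

lemma HasRanks.cons {N : ℕ} {L S : Set (Fin N → ℤ)} {k : ℕ} {m : Multiset ℕ}
    (hL : IsOrthantOfRank L k) (hS : HasRanks S m) (h : Disjoint L S) :
    HasRanks (L ∪ S) (k ::ₘ m) := by
  simpa using hL.hasRanks.union hS h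

lemma HasRanks.exists_of_cons {N : ℕ} {S : Set (Fin N → ℤ)} {k : ℕ} {m : Multiset ℕ}
    (hS : HasRanks S (k ::ₘ m)) :
    ∃ L T, IsOrthantOfRank L k ∧ HasRanks T m ∧ Disjoint L T ∧ S = L ∪ T := by
  classical
  obtain ⟨𝓛, h𝓛, hd, rfl, hm⟩ := hS
  obtain ⟨L, hL, rfl⟩ : ∃ L ∈ 𝓛, orthRank L = k := by
    simpa using (hm ▸ Multiset.mem_cons_self k m : k ∈ 𝓛.val.map orthRank)
  refine ⟨L, ⋃₀ (𝓛.erase L : Finset _), (h𝓛 L hL).isOrthantOfRank, ⟨𝓛.erase L,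
    fun M hM => h𝓛 M (Finset.mem_of_mem_erase hM), hd.subset (by simp), rfl, ?_⟩, ?_, ?_⟩
  · rw [Finset.erase_val, Multiset.map_erase_of_mem _ _ hL, hm, Multiset.erase_cons_head]
  · rw [Set.disjoint_sUnion_right]
    intro M hM
    have hM := Finset.mem_erase.mp hM
    exact hd hL hM.2 hM.1.symm
  · rw [← Set.sUnion_insert, ← Finset.coe_insert, Finset.insert_erase hL]

lemma HasRanks.eq_empty {N : ℕ} {S : Set (Fin N → ℤ)} (hS : HasRanks S 0) : S = ∅ := by
  obtain ⟨𝓛, -, -, rfl, hm⟩ := hS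
  simp_all

lemma HasRanks.orthRank_eq {N : ℕ} {S : Set (Fin N → ℤ)} {m : Multiset ℕ} (hS : HasRanks S m)
    {n : ℕ} (hn : n ∈ m) (hmax : ∀ k ∈ m, k ≤ n) : orthRank S = n := by
  obtain ⟨𝓛, h𝓛, -, rfl, rfl⟩ := hS
  obtain ⟨L, hL, rfl⟩ := Multiset.mem_map.mp hn
  refine PeiPaper.orthRank_eq (h𝓛 L hL).isOrthantOfRank (Set.subset_sUnion_of_mem hL) fun M k hM h => ?_
  obtain ⟨L', hL', K, hK, hKM⟩ :=
    hM.exists_subset_inter_of_subset_sUnion 𝓛.finite_toSet h𝓛 h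
  exact (hK.le_of_subset (h𝓛 L' hL').isOrthantOfRank (hKM.trans Set.inter_subset_right)).trans
    (hmax _ (Multiset.mem_map_of_mem _ hL'))

lemma HasRanks.heightAt_eq {N : ℕ} {S : Set (Fin N → ℤ)} {m : Multiset ℕ} (hS : HasRanks S m)
    {n : ℕ} (hmax : ∀ k ∈ m, k ≤ n) : heightAt S n = m.count n := by
  classical
  obtain ⟨𝓛, h𝓛, hd, rfl, rfl⟩ := hS
  set S : Set (Fin N → ℤ) := ⋃₀ 𝓛
  let F := 𝓛.filter fun L => n = orthRank L
  have hF : ∀ L : F, (L : Set (Fin N → ℤ)) ∈ germSet S n := fun L => by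
    obtain ⟨hL, hn⟩ := Finset.mem_filter.mp L.2
    exact ⟨hn ▸ (h𝓛 _ hL).isOrthantOfRank, Set.subset_sUnion_of_mem hL⟩
  have hcard : Multiset.count n (𝓛.val.map orthRank) = Nat.card F := by
    rw [Multiset.count_map, Nat.card_eq_fintype_card, Fintype.card_coe]
    rfl
  rw [hcard]
  symm
  refine Nat.card_eq_of_bijective (fun L : F => germOf S n ⟨L, hF L⟩) ⟨fun L L' h => ?_, fun g => ?_⟩
  · let P : Germ S n → Prop := Quot.lift
      (fun M : germSet S n => ∃ K, IsOrthantOfRank K n ∧ K ⊆ (M : Set (Fin N → ℤ)) ∩ L) fun M M' hMM' => by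
        have key : ∀ M M' : germSet S n, Commensurable M.1 M'.1 →
            (∃ K, IsOrthantOfRank K n ∧ K ⊆ (M : Set (Fin N → ℤ)) ∩ L) →
            ∃ K, IsOrthantOfRank K n ∧ K ⊆ (M' : Set (Fin N → ℤ)) ∩ L := by
          rintro M M' hc ⟨K, hK, hKM⟩
          obtain ⟨K', hK', hKM'⟩ := (commensurable_iff M.2.1 M'.2.1).mp hc
          obtain ⟨K'', hK'', hsub⟩ := M.2.1.exists_subset_inter hK hK'
            (hKM.trans Set.inter_subset_left) (hKM'.trans Set.inter_subset_left)
          exact ⟨K'', hK'', fun x hx => ⟨(hKM' (hsub hx).2).2, (hKM (hsub hx).1).2⟩⟩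
        have hsymm : Commensurable M'.1 M.1 := by
          rw [commensurable_iff M'.2.1 M.2.1, Set.inter_comm]
          exact (commensurable_iff M.2.1 M'.2.1).mp hMM'
        exact propext ⟨key M M' hMM', key M' M hsymm⟩
    have hP : P (germOf S n ⟨L, hF L⟩) := ⟨L, (hF L).1, by simp⟩
    rw [show germOf S n ⟨L, hF L⟩ = germOf S n ⟨L', hF L'⟩ from h] at hP
    obtain ⟨K, hK, hsub⟩ := hP
    obtain ⟨x, hx⟩ := hK.nonempty
    have hx := hsub hx
    exact Subtype.ext (hd.elim_set (Finset.mem_filter.mp L.2).1 (Finset.mem_filter.mp L'.2).1 x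
      hx.2 hx.1)
  · induction g using Quot.ind with
    | mk M =>
      obtain ⟨L, hL, K, hK, hsub⟩ :=
        M.2.1.exists_subset_inter_of_subset_sUnion 𝓛.finite_toSet h𝓛 M.2.2
      have hn : n = orthRank L := le_antisymm
        (hK.le_of_subset (h𝓛 L hL).isOrthantOfRank (hsub.trans Set.inter_subset_right))
        (hmax _ (Multiset.mem_map_of_mem _ hL))
      let L' : F := ⟨L, Finset.mem_filter.mpr ⟨hL, hn⟩⟩
      refine ⟨L', Quot.sound ((commensurable_iff (hF L').1 M.2.1).mpr ⟨K, hK, ?_⟩)⟩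
      rwa [Set.inter_comm]

lemma box_split {N : ℕ} (a : Fin N → ℤ) {ε : Fin N → SignType} {j : Fin N} (hj : ε j ≠ 0) :
    box a ε = box a (Function.update ε j 0) ∪ box (Function.update a j (a j + ε j)) ε := by
  ext x
  simp only [box, Set.mem_union, Set.mem_ofPred_eq]
  constructor
  · intro hx
    obtain ⟨t, ht⟩ := hx j
    rcases t with _ | t
    · refine Or.inl fun i => ?_
      by_cases hi : i = j
      · subst hi
        exact ⟨0, by simpa using ht⟩
      · simpa [hi] using hx i
    · refine Or.inr fun i => ?_
      by_cases hi : i = j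
      · subst hi
        exact ⟨t, by rw [ht]; push_cast; simp; ring⟩
      · simpa [hi] using hx i
  · rintro (hx | hx) <;> intro i <;> by_cases hi : i = j
    · subst hi
      obtain ⟨t, ht⟩ := hx i
      exact ⟨0, by simpa using ht⟩
    · simpa [hi] using hx i
    · subst hi
      obtain ⟨t, ht⟩ := hx i
      exact ⟨t + 1, by rw [ht]; push_cast; simp; ring⟩
    · simpa [hi] using hx i

lemma box_split_disjoint {N : ℕ} (a : Fin N → ℤ) {ε : Fin N → SignType} {j : Fin N}
    (hj : ε j ≠ 0) :
    Disjoint (box a (Function.update ε j 0)) (box (Function.update a j (a j + ε j)) ε) := by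
  rw [Set.disjoint_left]
  intro x hx hx'
  obtain ⟨t, ht⟩ := hx j
  obtain ⟨t', ht'⟩ := hx' j
  cases h : ε j <;> simp_all <;> omega

lemma directions_update {N : ℕ} (ε : Fin N → SignType) (j : Fin N) :
    directions (Function.update ε j 0) = (directions ε).erase j := by
  ext i
  by_cases hi : i = j
  · subst hi
    simp [mem_directions]
  · simp [mem_directions, hi]

lemma IsOrthantOfRank.exists_split {N : ℕ} {L : Set (Fin N → ℤ)} {k : ℕ}
    (hL : IsOrthantOfRank L (k + 1)) :
    ∃ L₁ L₂, IsOrthantOfRank L₁ k ∧ IsOrthantOfRank L₂ (k + 1) ∧ Disjoint L₁ L₂ ∧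
      L = L₁ ∪ L₂ := by
  obtain ⟨a, ε, hcard, rfl⟩ := hL.exists_box
  obtain ⟨j, hj⟩ := Finset.card_pos.mp (hcard.symm ▸ k.succ_pos : 0 < (directions ε).card)
  have hj' := mem_directions.mp hj
  refine ⟨_, _, ?_, ?_, box_split_disjoint a hj', box_split a hj'⟩
  · convert isOrthantOfRank_box a (Function.update ε j 0)
    rw [directions_update, Finset.card_erase_of_mem hj, hcard, Nat.add_sub_cancel]
  · exact hcard ▸ isOrthantOfRank_box _ ε

lemma HasRanks.cons_pred {N : ℕ} {S : Set (Fin N → ℤ)} {m : Multiset ℕ} {k : ℕ}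
    (hS : HasRanks S m) (hk : k + 1 ∈ m) : HasRanks S (k ::ₘ m) := by
  obtain ⟨m, rfl⟩ := Multiset.exists_cons_of_mem hk
  obtain ⟨L, T, hL, hT, hd, rfl⟩ := hS.exists_of_cons
  obtain ⟨L₁, L₂, h₁, h₂, h₁₂, rfl⟩ := hL.exists_split
  rw [Set.disjoint_union_left] at hd
  rw [Set.union_assoc]
  exact .cons h₁ (.cons h₂ hT hd.2) (Set.disjoint_union_right.mpr ⟨h₁₂, hd.1⟩)

lemma multiset_Ico_eq_cons {k n : ℕ} (h : k < n) :
    Multiset.Ico k n = k ::ₘ Multiset.Ico (k + 1) n := by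
  have := congrArg Finset.val (Finset.insert_Ico_add_one_left_eq_Ico h)
  rw [Finset.insert_val_of_notMem (by simp)] at this
  exact this.symm

lemma HasRanks.add_Ico {N : ℕ} {S : Set (Fin N → ℤ)} {m : Multiset ℕ} {k n : ℕ}
    (hS : HasRanks S m) (hn : n ∈ m) (hk : k ≤ n) : HasRanks S (m + Multiset.Ico k n) := by
  induction hk using Nat.decreasingInduction with
  | self => simpa using hS
  | of_succ k hk ih =>
    rw [multiset_Ico_eq_cons hk, Multiset.add_cons]
    refine ih.cons_pred ?_
    rw [Multiset.mem_add, Multiset.mem_Ico]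
    rcases Nat.eq_or_lt_of_le (Nat.succ_le_of_lt hk) with h | h
    · exact Or.inl (by rwa [show k + 1 = n from h])
    · exact Or.inr ⟨le_rfl, h⟩

lemma HasRanks.add_bind_Ico {N : ℕ} {S : Set (Fin N → ℤ)} {m : Multiset ℕ} {n : ℕ}
    (hS : HasRanks S m) (hn : n ∈ m) (c : Multiset ℕ) (hc : ∀ k ∈ c, k < n) :
    HasRanks S (m + c.bind fun k => Multiset.Ico k n) := by
  induction c using Multiset.induction with
  | empty => simpa using hS
  | cons k c ih =>
    have := (ih fun i hi => hc i (Multiset.mem_cons_of_mem hi)).add_Ico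
      (Multiset.mem_add.mpr (.inl hn)) (hc k (Multiset.mem_cons_self k c)).le
    rwa [Multiset.cons_bind, add_comm (Multiset.Ico k n), ← add_assoc]

lemma HasRanks.bind_Ico_of_add {N : ℕ} {S : Set (Fin N → ℤ)} {n : ℕ} (c : Multiset ℕ)
    (hc : ∀ k ∈ c, k < n) {m : Multiset ℕ} (hS : HasRanks S (m + c)) (hn : n ∈ m) :
    HasRanks S (m + c.bind fun k => Multiset.Ico k n) := by
  induction c using Multiset.induction generalizing m with
  | empty => simpa using hS
  | cons k c ih =>
    rw [Multiset.add_cons, ← Multiset.cons_add] at hS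
    have hk := hc k (Multiset.mem_cons_self k c)
    have := (ih (fun i hi => hc i (Multiset.mem_cons_of_mem hi)) hS
      (Multiset.mem_cons_of_mem hn)).add_Ico
      (Multiset.mem_add.mpr (.inl (Multiset.mem_cons_of_mem hn))) (Nat.succ_le_of_lt hk)
    rw [Multiset.cons_bind, multiset_Ico_eq_cons hk]
    convert this using 1
    simp only [← Multiset.singleton_add]
    abel

lemma HasRanks.exists_common {N : ℕ} {S T : Set (Fin N → ℤ)} {m m' : Multiset ℕ} {n : ℕ}
    (hS : HasRanks S m) (hT : HasRanks T m') (hn : n ∈ m) (hm : ∀ k ∈ m, k ≤ n)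
    (hm' : ∀ k ∈ m', k ≤ n) (hcount : m.count n = m'.count n) :
    ∃ p, HasRanks S p ∧ HasRanks T p := by
  set R := Multiset.replicate (m.count n) n with hR
  have hsplit : ∀ p : Multiset ℕ, p.count n = m.count n →
      R + p.filter (· ≠ n) = p := fun p hp => by
    rw [hR, ← hp, ← Multiset.filter_eq' p n]
    exact Multiset.filter_add_not _ _
  have hlt : ∀ p : Multiset ℕ, (∀ k ∈ p, k ≤ n) → ∀ k ∈ p.filter (· ≠ n), k < n := fun p hp k hk =>
    lt_of_le_of_ne (hp k (Multiset.mem_filter.mp hk).1) (Multiset.mem_filter.mp hk).2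
  have hnR : n ∈ R := Multiset.mem_replicate.mpr
    ⟨(Multiset.count_pos.mpr hn).ne', rfl⟩
  rw [← hsplit m rfl] at hS
  rw [← hsplit m' hcount.symm] at hT
  refine ⟨_, (hS.bind_Ico_of_add _ (hlt m hm) hnR).add_bind_Ico
    (Multiset.mem_add.mpr (.inl hnR)) _ (hlt m' hm'), ?_⟩
  rw [add_right_comm]
  exact (hT.bind_Ico_of_add _ (hlt m' hm') hnR).add_bind_Ico
    (Multiset.mem_add.mpr (.inl hnR)) _ (hlt m hm)

/-- A set which cuts every finite disjoint union of orthants into two such unions. -/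
def IsCutting {N : ℕ} (H : Set (Fin N → ℤ)) : Prop :=
  ∀ S m, HasRanks S m → (∃ p, HasRanks (S ∩ H) p) ∧ ∃ p, HasRanks (S ∩ Hᶜ) p

lemma IsCutting.compl {N : ℕ} {H : Set (Fin N → ℤ)} (hH : IsCutting H) : IsCutting Hᶜ :=
  fun S m hS => ⟨(hH S m hS).2, by simpa using (hH S m hS).1⟩

lemma IsCutting.inter {N : ℕ} {H H' : Set (Fin N → ℤ)} (hH : IsCutting H) (hH' : IsCutting H') :
    IsCutting (H ∩ H') := fun S m hS => by
  obtain ⟨⟨p, hp⟩, q, hq⟩ := hH S m hS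
  obtain ⟨⟨p₁, hp₁⟩, p₂, hp₂⟩ := hH' _ _ hp
  refine ⟨⟨p₁, by rwa [← Set.inter_assoc]⟩, q + p₂, ?_⟩
  convert hq.union hp₂ ?_ using 1
  · ext x
    simp only [Set.mem_inter_iff, Set.mem_compl_iff, Set.mem_union]
    tauto
  · rw [Set.disjoint_left]
    exact fun x hx hx' => hx.2 hx'.1.2

lemma isCutting_univ {N : ℕ} : IsCutting (Set.univ : Set (Fin N → ℤ)) :=
  fun _ m hS => ⟨⟨m, by simpa using hS⟩, 0, by simpa using HasRanks.empty⟩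

lemma isCutting_of_box {N : ℕ} {H : Set (Fin N → ℤ)}
    (hH : ∀ a ε, (∃ p, HasRanks (box a ε ∩ H) p) ∧ ∃ p, HasRanks (box a ε ∩ Hᶜ) p) :
    IsCutting H := fun S m hS => by
  induction m using Multiset.induction generalizing S with
  | empty =>
    rw [hS.eq_empty]
    exact ⟨⟨0, by simpa using HasRanks.empty⟩, 0, by simpa using HasRanks.empty⟩
  | cons k m ih =>
    obtain ⟨L, T, hL, hT, hd, rfl⟩ := hS.exists_of_cons
    obtain ⟨⟨p, hp⟩, q, hq⟩ := ih T hT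
    obtain ⟨a, ε, -, rfl⟩ := hL.exists_box
    obtain ⟨⟨p', hp'⟩, q', hq'⟩ := hH a ε
    rw [Set.union_inter_distrib_right, Set.union_inter_distrib_right]
    exact ⟨⟨_, hp'.union hp (hd.mono Set.inter_subset_left Set.inter_subset_left)⟩,
      _, hq'.union hq (hd.mono Set.inter_subset_left Set.inter_subset_left)⟩

lemma isCutting_halfSpace {N : ℕ} (j : Fin N) (c : ℤ) :
    IsCutting {x : Fin N → ℤ | x j ≤ c} := by
  refine isCutting_of_box ?_
  set H := {x : Fin N → ℤ | x j ≤ c}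
  have hsub : ∀ a ε, box a ε ⊆ H →
      (∃ p, HasRanks (box a ε ∩ H) p) ∧ ∃ p, HasRanks (box a ε ∩ Hᶜ) p := fun a ε h =>
    ⟨⟨_, by simpa [Set.inter_eq_left.mpr h] using (isOrthantOfRank_box a ε).hasRanks⟩, 0, by
      rw [(Set.disjoint_compl_right_iff_subset.mpr h).inter_eq]
      exact HasRanks.empty⟩
  have hsub' : ∀ a ε, box a ε ⊆ Hᶜ →
      (∃ p, HasRanks (box a ε ∩ H) p) ∧ ∃ p, HasRanks (box a ε ∩ Hᶜ) p := fun a ε h =>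
    ⟨⟨0, by
      rw [(Set.subset_compl_iff_disjoint_right.mp h).inter_eq]
      exact HasRanks.empty⟩,
      _, by simpa [Set.inter_eq_left.mpr h] using (isOrthantOfRank_box a ε).hasRanks⟩
  have hzero : ∀ a ε, ε j = 0 →
      (∃ p, HasRanks (box a ε ∩ H) p) ∧ ∃ p, HasRanks (box a ε ∩ Hᶜ) p := fun a ε h => by
    have hx : ∀ x ∈ box a ε, x j = a j := fun x hx => by
      obtain ⟨t, ht⟩ := hx j
      simpa [h] using ht
    by_cases hc : a j ≤ c
    · exact hsub a ε fun x hxb => (hx x hxb).trans_le hc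
    · exact hsub' a ε fun x hxb => by simpa [H, hx x hxb] using hc
  suffices h : ∀ (n : ℕ) a ε, ((ε j : ℤ) * (c - a j) + 1).toNat ≤ n →
      (∃ p, HasRanks (box a ε ∩ H) p) ∧ ∃ p, HasRanks (box a ε ∩ Hᶜ) p from
    fun a ε => h _ a ε le_rfl
  intro n
  induction n with
  | zero =>
    intro a ε hn
    cases h : ε j with
    | zero => exact hzero a ε h
    | neg =>
      refine hsub a ε fun x hx => ?_
      obtain ⟨t, ht⟩ := hx j
      simp [h] at hn ht
      simp only [H, Set.mem_ofPred_eq]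
      omega
    | pos =>
      refine hsub' a ε fun x hx => ?_
      obtain ⟨t, ht⟩ := hx j
      simp [h] at hn ht
      simp only [H, Set.mem_compl_iff, Set.mem_ofPred_eq]
      omega
  | succ n ih =>
    intro a ε hn
    by_cases h : ε j = 0
    · exact hzero a ε h
    have hd := box_split_disjoint a h
    obtain ⟨⟨p, hp⟩, q, hq⟩ := hzero a (Function.update ε j 0) (by simp)
    obtain ⟨⟨p', hp'⟩, q', hq'⟩ := ih (Function.update a j (a j + ε j)) ε (by
      cases h' : ε j <;> simp [h'] at * <;> omega)
    rw [box_split a h, Set.union_inter_distrib_right, Set.union_inter_distrib_right]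
    exact ⟨⟨_, hp.union hp' (hd.mono Set.inter_subset_left Set.inter_subset_left)⟩,
      _, hq.union hq' (hd.mono Set.inter_subset_left Set.inter_subset_left)⟩

lemma isCutting_coordinate {N : ℕ} (j : Fin N) (a : ℤ) (e : SignType) :
    IsCutting {x : Fin N → ℤ | ∃ t : ℕ, x j = a + (e : ℤ) * t} := by
  have hle := isCutting_halfSpace j a
  have hge := (isCutting_halfSpace j (a - 1)).compl
  cases e with
  | zero =>
    convert hle.inter hge using 1
    ext x
    simp
    omega
  | neg =>
    convert hle using 1
    ext x
    exact ⟨fun ⟨t, ht⟩ => by simp at ht ⊢; omega,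
      fun h => ⟨(a - x j).toNat, by simp at h ⊢; omega⟩⟩
  | pos =>
    convert hge using 1
    ext x
    exact ⟨fun ⟨t, ht⟩ => by simp at ht ⊢; omega,
      fun h => ⟨(x j - a).toNat, by simp at h ⊢; omega⟩⟩

lemma isCutting_box {N : ℕ} (a : Fin N → ℤ) (ε : Fin N → SignType) : IsCutting (box a ε) := by
  classical
  suffices h : ∀ s : Finset (Fin N),
      IsCutting {x : Fin N → ℤ | ∀ j ∈ s, ∃ t : ℕ, x j = a j + (ε j : ℤ) * t} by
    simpa [box] using h Finset.univ
  intro s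
  induction s using Finset.induction with
  | empty => simpa using isCutting_univ
  | insert j s _ ih =>
    convert (isCutting_coordinate j (a j) (ε j)).inter ih using 1
    ext x
    simp

lemma IsOrthohedral.exists_hasRanks {N : ℕ} {S : Set (Fin N → ℤ)} (hS : IsOrthohedral S) :
    ∃ m, HasRanks S m := by
  obtain ⟨𝓛, hfin, h𝓛, rfl⟩ := hS
  induction 𝓛, hfin using Set.Finite.induction_on with
  | empty => exact ⟨0, by simpa using HasRanks.empty⟩
  | @insert L 𝓛 _ _ ih =>
    obtain ⟨m, hm⟩ := ih fun M hM => h𝓛 M (Set.mem_insert_of_mem L hM)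
    obtain ⟨k, hL⟩ := h𝓛 L (Set.mem_insert L 𝓛)
    obtain ⟨a, ε, -, rfl⟩ := hL.exists_box
    obtain ⟨p, hp⟩ := (isCutting_box a ε _ _ hm).2
    refine ⟨k ::ₘ p, ?_⟩
    convert hp.cons hL ?_ using 1
    · rw [Set.sUnion_insert, Set.inter_comm, ← Set.sdiff_eq_compl_inter, Set.union_sdiff_self]
    · rw [Set.disjoint_left]
      exact fun x hx hx' => hx'.2 hx

lemma IsometricOn.isOrthantOfRank_image {N : ℕ} {f : (Fin N → ℤ) → (Fin N → ℤ)}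
    {L : Set (Fin N → ℤ)} {k : ℕ} (hf : IsometricOn f L) (hL : IsOrthantOfRank L k) :
    IsOrthantOfRank (f '' L) k := by
  obtain ⟨b, B, hB, hfB⟩ := hf
  obtain ⟨a, A, Y, hA, hY, rfl⟩ := hL
  refine ⟨b + B.mulVec a, B * A, Y, hB.mul hA, hY, ?_⟩
  rw [Set.image_image]
  refine Set.image_congr fun v hv => ?_
  rw [hfB _ (Set.mem_image_of_mem _ hv), Matrix.mulVec_add, Matrix.mulVec_mulVec, add_assoc]

lemma IsOrthantOfRank.exists_isometry {N : ℕ} {L L' : Set (Fin N → ℤ)} {k : ℕ}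
    (hL : IsOrthantOfRank L k) (hL' : IsOrthantOfRank L' k) :
    ∃ (b : Fin N → ℤ) (B : Matrix (Fin N) (Fin N) ℤ),
      IsOrthMat B ∧ (fun x => b + B.mulVec x) '' L = L' := by
  obtain ⟨a, A, Y, hA, hY, rfl⟩ := hL
  obtain ⟨a', A', Y', hA', hY', rfl⟩ := hL'
  obtain ⟨e⟩ : Nonempty (Y' ≃ Y) := ⟨Finset.equivOfCardEq (hY'.trans hY.symm)⟩
  let σ : Equiv.Perm (Fin N) := Equiv.extendSubtype (p := (· ∈ Y')) (q := (· ∈ Y)) e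
  have hσ : ∀ i, σ i ∈ Y ↔ i ∈ Y' := fun i =>
    ⟨fun h => by_contra fun hi => Equiv.extendSubtype_not_mem _ i hi h,
      fun h => Equiv.extendSubtype_mem _ i h⟩
  set B := A' * σ.permMatrix ℤ * A.transpose with hB
  refine ⟨a' - B.mulVec a, B, (hA'.mul (isOrthMat_permMatrix σ)).mul hA.transpose, ?_⟩
  have hmul : ∀ v, a' - B.mulVec a + B.mulVec (a + A.mulVec v) = a' + A'.mulVec (v ∘ σ) := fun v => by
    rw [Matrix.mulVec_add, Matrix.mulVec_mulVec, hB, Matrix.mul_assoc _ A.transpose,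
      hA.transpose_mul_self, Matrix.mul_one, ← add_assoc, sub_add_cancel, ← Matrix.mulVec_mulVec _ A',
      Matrix.permMatrix_mulVec]
  rw [Set.image_image]
  simp only [hmul]
  ext x
  constructor
  · rintro ⟨v, ⟨hv0, hvY⟩, rfl⟩
    exact ⟨v ∘ σ, ⟨fun i => hv0 _, fun i hi => hvY _ (by rwa [hσ])⟩, rfl⟩
  · rintro ⟨v, ⟨hv0, hvY⟩, rfl⟩
    refine ⟨v ∘ σ.symm, ⟨fun i => hv0 _, fun i hi => hvY _ ?_⟩, ?_⟩
    · rwa [← hσ, Equiv.apply_symm_apply]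
    · simp [Function.comp_assoc]

lemma IsOrthMat.injective {N : ℕ} {B : Matrix (Fin N) (Fin N) ℤ} (hB : IsOrthMat B)
    (b : Fin N → ℤ) : Function.Injective fun x => b + B.mulVec x := fun x y h => by
  have := congrArg B.transpose.mulVec (add_left_cancel h)
  simpa [Matrix.mulVec_mulVec, hB.transpose_mul_self] using this

lemma HasRanks.peiIsomorphic {N : ℕ} {S T : Set (Fin N → ℤ)} {m : Multiset ℕ}
    (hS : HasRanks S m) (hT : HasRanks T m) : PeiIsomorphic S T := by
  classical
  induction m using Multiset.induction generalizing S T with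
  | empty =>
    rw [hS.eq_empty, hT.eq_empty]
    exact ⟨id, ⟨∅, by simp⟩, by simp, by simp⟩
  | cons k m ih =>
    obtain ⟨L, S', hL, hS', hd, rfl⟩ := hS.exists_of_cons
    obtain ⟨L', T', hL', hT', hd', rfl⟩ := hT.exists_of_cons
    obtain ⟨f, ⟨𝓛, hfin, h𝓛, rfl, hpd, hiso⟩, hinj, rfl⟩ := ih hS' hT'
    obtain ⟨b, B, hB, rfl⟩ := hL.exists_isometry hL'
    set g : (Fin N → ℤ) → (Fin N → ℤ) := L.piecewise (fun x => b + B.mulVec x) f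
    have hgL : Set.EqOn g (fun x => b + B.mulVec x) L := Set.piecewise_eqOn _ _ _
    have hgS : Set.EqOn g f (⋃₀ 𝓛) := fun x hx =>
      Set.piecewise_eq_of_notMem _ _ _ (hd.notMem_of_mem_right hx)
    refine ⟨g, ⟨insert L 𝓛, hfin.insert L, ?_, (Set.sUnion_insert _ _).symm, ?_, ?_⟩, ?_, ?_⟩
    · rintro M (rfl | hM)
      exacts [⟨k, hL⟩, h𝓛 M hM]
    · exact hpd.insert fun M hM _ => hd.mono_right (Set.subset_sUnion_of_mem hM)
    · rintro M (rfl | hM)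
      · exact ⟨b, B, hB, hgL⟩
      · obtain ⟨a, A, hA, hfA⟩ := hiso M hM
        exact ⟨a, A, hA, fun x hx => (hgS (Set.mem_sUnion_of_mem hx hM)).trans (hfA x hx)⟩
    · rw [Set.injOn_union hd]
      refine ⟨(hB.injective b).injOn.congr hgL.symm, hinj.congr hgS.symm, fun x hx y hy => ?_⟩
      rw [hgL hx, hgS hy]
      exact hd'.ne_of_mem (Set.mem_image_of_mem _ hx) (Set.mem_image_of_mem _ hy)
    · rw [Set.image_union, hgL.image_eq, hgS.image_eq]

lemma PeiIsomorphic.exists_hasRanks {N : ℕ} {S T : Set (Fin N → ℤ)} (h : PeiIsomorphic S T) :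
    ∃ m, HasRanks S m ∧ HasRanks T m := by
  obtain ⟨f, ⟨𝓛, hfin, h𝓛, rfl, hpd, hiso⟩, hinj, rfl⟩ := h
  induction 𝓛, hfin using Set.Finite.induction_on with
  | empty => exact ⟨0, by simpa using HasRanks.empty, by simpa using HasRanks.empty⟩
  | @insert L 𝓛 hL𝓛 _ ih =>
    obtain ⟨k, hL⟩ := h𝓛 L (Set.mem_insert L 𝓛)
    have hsub := Set.subset_insert L 𝓛
    obtain ⟨m, hm, hm'⟩ := ih (fun M hM => h𝓛 M (hsub hM)) (hpd.subset hsub)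
      (fun M hM => hiso M (hsub hM)) (hinj.mono (Set.sUnion_mono hsub))
    have hd : Disjoint L (⋃₀ 𝓛) := by
      rw [Set.disjoint_sUnion_right]
      exact ((Set.pairwiseDisjoint_insert_of_notMem hL𝓛).mp hpd).2
    rw [Set.sUnion_insert] at hinj ⊢
    refine ⟨k ::ₘ m, hm.cons hL hd, ?_⟩
    rw [Set.image_union]
    refine hm'.cons ((hiso L (Set.mem_insert L 𝓛)).isOrthantOfRank_image hL) ?_
    rw [Set.disjoint_iff_inter_eq_empty,
      ← hinj.image_inter Set.subset_union_left Set.subset_union_right, hd.inter_eq, Set.image_empty]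

lemma multiset_sup_mem {m : Multiset ℕ} (hm : m ≠ 0) : m.sup ∈ m := by
  induction m using Multiset.induction with
  | empty => exact absurd rfl hm
  | cons k m ih =>
    rcases eq_or_ne m 0 with rfl | h0
    · simp
    · rw [Multiset.sup_cons]
      rcases le_total k m.sup with h | h
      · rw [sup_eq_right.mpr h]
        exact Multiset.mem_cons_of_mem (ih h0)
      · rw [sup_eq_left.mpr h]
        exact Multiset.mem_cons_self k m

lemma multiset_sup_replicate {h : ℕ} (hh : h ≠ 0) (n : ℕ) : (Multiset.replicate h n).sup = n :=
  Multiset.eq_of_mem_replicate (multiset_sup_mem fun h0 => hh (by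
    simpa using congrArg Multiset.card h0))

lemma HasRanks.orthRank_eq_sup {N : ℕ} {S : Set (Fin N → ℤ)} {m : Multiset ℕ}
    (hS : HasRanks S m) : orthRank S = m.sup := by
  rcases eq_or_ne m 0 with rfl | h0
  · have h0 : {k | ∃ L : Set (Fin N → ℤ), IsOrthantOfRank L k ∧ L ⊆ ∅} = ∅ :=
      Set.eq_empty_of_forall_notMem fun k ⟨L, hL, hsub⟩ => (hL.nonempty.mono hsub).ne_empty rfl
    rw [hS.eq_empty, orthRank, h0, csSup_empty]
    rfl
  · exact hS.orthRank_eq (multiset_sup_mem h0) fun k hk => Multiset.le_sup hk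

lemma HasRanks.height_eq_count {N : ℕ} {S : Set (Fin N → ℤ)} {m : Multiset ℕ}
    (hS : HasRanks S m) : height S = m.count m.sup := by
  rw [height, hS.orthRank_eq_sup]
  exact hS.heightAt_eq fun k hk => Multiset.le_sup hk

lemma HasRanks.orthRank_le {N : ℕ} {S : Set (Fin N → ℤ)} {m : Multiset ℕ}
    (hS : HasRanks S m) : orthRank S ≤ N := by
  rcases eq_or_ne m 0 with rfl | h0
  · simp [hS.orthRank_eq_sup]
  · obtain ⟨m', hm'⟩ := Multiset.exists_cons_of_mem (multiset_sup_mem h0)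
    rw [hS.orthRank_eq_sup]
    rw [hm'] at hS
    obtain ⟨L, -, hL, -⟩ := hS.exists_of_cons
    obtain ⟨a, ε, hcard, -⟩ := hL.exists_box
    rw [← hcard]
    exact (Finset.card_le_univ _).trans_eq (Fintype.card_fin N)

lemma HasRanks.peiIsomorphic_of_sup_count {N : ℕ} {S T : Set (Fin N → ℤ)} {m m' : Multiset ℕ}
    (hS : HasRanks S m) (hT : HasRanks T m') (hsup : m.sup = m'.sup)
    (hcount : m.count m.sup = m'.count m.sup) : PeiIsomorphic S T := by
  rcases eq_or_ne m 0 with rfl | h0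
  · rcases eq_or_ne m' 0 with rfl | h0'
    · exact hS.peiIsomorphic hT
    · rw [hsup, Multiset.count_zero] at hcount
      exact absurd hcount.symm (Multiset.count_pos.mpr (multiset_sup_mem h0')).ne'
  · obtain ⟨p, hp, hp'⟩ := hS.exists_common hT (multiset_sup_mem h0)
      (fun k hk => Multiset.le_sup hk) (fun k hk => hsup ▸ Multiset.le_sup hk) hcount
    exact hp.peiIsomorphic hp'

lemma emb_eq_snoc {N : ℕ} (x : Fin N → ℤ) : emb N x = Fin.snoc (α := fun _ => ℤ) x 0 := by
  ext i
  refine Fin.lastCases ?_ (fun i => ?_) i <;> simp [emb]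

lemma emb_injective (N : ℕ) : Function.Injective (emb N) := fun x y h => by
  rw [emb_eq_snoc, emb_eq_snoc] at h
  exact (Fin.snoc_inj.mp h).1

lemma directions_snoc_card {N : ℕ} (ε : Fin N → SignType) :
    (directions (Fin.snoc (α := fun _ => SignType) ε 0)).card = (directions ε).card := by
  simp [directions, Finset.card_filter, Fin.sum_univ_castSucc]

lemma emb_image_box {N : ℕ} (a : Fin N → ℤ) (ε : Fin N → SignType) :
    emb N '' box a ε = box (emb N a) (Fin.snoc (α := fun _ => SignType) ε 0) := by
  ext x
  simp only [emb_eq_snoc]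
  constructor
  · rintro ⟨y, hy, rfl⟩ i
    refine Fin.lastCases ⟨0, by simp⟩ (fun i => ?_) i
    simpa [emb_eq_snoc] using hy i
  · intro hx
    refine ⟨fun i => x i.castSucc, fun i => by simpa using hx i.castSucc, ?_⟩
    ext i
    refine Fin.lastCases ?_ (fun i => by simp) i
    obtain ⟨t, ht⟩ := hx (Fin.last N)
    simpa [emb_eq_snoc] using ht.symm

lemma IsOrthantOfRank.emb_image {N : ℕ} {L : Set (Fin N → ℤ)} {k : ℕ}
    (hL : IsOrthantOfRank L k) : IsOrthantOfRank (emb N '' L) k := by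
  obtain ⟨a, ε, rfl, rfl⟩ := hL.exists_box
  rw [emb_image_box, ← directions_snoc_card]
  exact isOrthantOfRank_box _ _

lemma HasRanks.emb_image {N : ℕ} {S : Set (Fin N → ℤ)} {m : Multiset ℕ} (hS : HasRanks S m) :
    HasRanks (emb N '' S) m := by
  induction m using Multiset.induction generalizing S with
  | empty =>
    rw [hS.eq_empty, Set.image_empty]
    exact .empty
  | cons k m ih =>
    obtain ⟨L, T, hL, hT, hd, rfl⟩ := hS.exists_of_cons
    rw [Set.image_union]
    exact (ih hT).cons hL.emb_image ((Set.disjoint_image_iff (emb_injective N)).mpr hd)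

lemma IsOrthantOfRank.vadd {N : ℕ} {L : Set (Fin N → ℤ)} {k : ℕ} (hL : IsOrthantOfRank L k)
    (a : Fin N → ℤ) : IsOrthantOfRank (a +ᵥ L) k := by
  obtain ⟨b, A, Y, hA, hY, rfl⟩ := hL
  refine ⟨a + b, A, Y, hA, hY, ?_⟩
  rw [← Set.image_vadd, Set.image_image]
  simp [add_assoc]

lemma IsStack.hasRanks {N : ℕ} {S : Set (Fin N → ℤ)} {n h : ℕ} (hS : IsStack S n h) :
    HasRanks S (Multiset.replicate h n) := by
  classical
  obtain ⟨L, a, hL, hd, rfl⟩ := hS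
  suffices H : ∀ s : Finset (Fin h),
      HasRanks (⋃ i ∈ s, a i +ᵥ L) (Multiset.replicate s.card n) by
    simpa using H Finset.univ
  intro s
  induction s using Finset.induction with
  | empty => simpa using HasRanks.empty
  | insert i s hi ih =>
    rw [Finset.set_biUnion_insert, Finset.card_insert_of_notMem hi, Multiset.replicate_succ]
    refine ih.cons (hL.vadd (a i)) ?_
    simp only [Set.disjoint_iUnion_right]
    exact fun j hj => hd (ne_of_mem_of_not_mem hj hi).symm

/-- Translates of a rank-`n` orthant of `ℤ^N` along the last coordinate of `ℤ^{N+1}` are disjoint. -/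
lemma exists_isStack {N n : ℕ} (hn : n ≤ N) (h : ℕ) :
    ∃ S : Set (Fin (N + 1) → ℤ), IsStack S n h := by
  obtain ⟨Y, hY⟩ : ∃ Y : Finset (Fin N), Y.card = n := by
    obtain ⟨Y, -, hY⟩ := Finset.exists_subset_card_eq (s := (Finset.univ : Finset (Fin N)))
      (by simpa using hn)
    exact ⟨Y, hY⟩
  have hL : IsOrthantOfRank (stdFace N Y) n :=
    ⟨0, 1, Y, by simp [IsOrthMat], hY, by simp⟩
  refine ⟨_, emb N '' stdFace N Y, fun i => Pi.single (Fin.last N) (i : ℤ), hL.emb_image, ?_, rfl⟩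
  intro i j hij
  rw [Set.disjoint_left]
  rintro _ ⟨_, ⟨x, -, rfl⟩, rfl⟩ ⟨_, ⟨y, -, rfl⟩, hxy⟩
  have := congrFun hxy (Fin.last N)
  simp [emb_eq_snoc] at this
  exact hij (Fin.ext this.symm)

/-- pei-normal form: every orthohedral set is pei-isomorphic to a stack of
orthants; consequently two orthohedral sets are pei-isomorphic iff they have the same
rank and height. -/
theorem stmt6 {N : ℕ} :
    (∀ S : Set (Fin N → ℤ), IsOrthohedral S →
      ∃ S' : Set (Fin (N + 1) → ℤ), IsStack S' (orthRank S) (height S) ∧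
        PeiIsomorphic (emb N '' S) S') ∧
    (∀ S T : Set (Fin N → ℤ), IsOrthohedral S → IsOrthohedral T →
      (PeiIsomorphic (emb N '' S) (emb N '' T) ↔
        orthRank S = orthRank T ∧ height S = height T)) := by
  refine ⟨fun S hS => ?_, fun S T hS hT => ⟨fun h => ?_, fun ⟨hrank, hheight⟩ => ?_⟩⟩
  · obtain ⟨m, hm⟩ := hS.exists_hasRanks
    obtain ⟨S', hS'⟩ := exists_isStack (hm.orthRank_le) (height S)
    refine ⟨S', hS', ?_⟩
    rw [hm.orthRank_eq_sup, hm.height_eq_count] at hS'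
    refine hm.emb_image.peiIsomorphic_of_sup_count hS'.hasRanks ?_ ?_
    · rcases eq_or_ne m 0 with rfl | h0
      · simp
      · exact (multiset_sup_replicate (Multiset.count_pos.mpr (multiset_sup_mem h0)).ne' _).symm
    · rw [Multiset.count_replicate_self]
  · obtain ⟨m, hm⟩ := hS.exists_hasRanks
    obtain ⟨m', hm'⟩ := hT.exists_hasRanks
    obtain ⟨p, hp, hp'⟩ := h.exists_hasRanks
    refine ⟨?_, ?_⟩
    · rw [hm.orthRank_eq_sup, hm'.orthRank_eq_sup, ← hm.emb_image.orthRank_eq_sup,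
        ← hm'.emb_image.orthRank_eq_sup, hp.orthRank_eq_sup, hp'.orthRank_eq_sup]
    · rw [hm.height_eq_count, hm'.height_eq_count, ← hm.emb_image.height_eq_count,
        ← hm'.emb_image.height_eq_count, hp.height_eq_count, hp'.height_eq_count]
  · obtain ⟨m, hm⟩ := hS.exists_hasRanks
    obtain ⟨m', hm'⟩ := hT.exists_hasRanks
    rw [hm.orthRank_eq_sup, hm'.orthRank_eq_sup] at hrank
    rw [hm.height_eq_count, hm'.height_eq_count] at hheight
    refine hm.emb_image.peiIsomorphic_of_sup_count hm'.emb_image hrank ?_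
    rw [hheight, hrank]

end PeiPaper
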